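/- arXiv:1604.00303 — 2 statements merged into one kernel-verified Lean document; each statement's English description precedes it below -/
import Mathlib

section
/- Let k ≥ 2 be an integer and λ ∈ ℂ, and let a_n(λ,k) be defined by the recurrence a_{−1} = 0, a_0 = 1, a_{n+2} = A_n(λ,k)·a_{n+1} + B_n(λ,k)·a_n. If the power series ∑_{n≥0} a_n(λ,k) xⁿ has radius of convergence R > 0, then its sum y(x) satisfies the Heun equation y''(x) + (1/2)((k+6)/x + (2λ−k+1)/(x−1))y'(x) + (1/4)·((λ+3)(λ+2)x + (kλ² + 5kλ + 2k − 4))/(x(x−1)(x+k))·y(x) = 0 for all real x with 0 < x < min(R,1). -/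
/-- Recurrence coefficient `A_n(λ,k)`. -/
noncomputable def Acoef (k : ℕ) (lam : ℂ) (n : ℤ) : ℂ :=
  ((k : ℂ) * lam ^ 2 + (k : ℂ) * (4 * (n : ℂ) + 9) * lam + 4 * (k : ℂ) * (n : ℂ) ^ 2
      + 16 * (n : ℂ) * (k : ℂ) - 4 * (n : ℂ) ^ 2 + 14 * (k : ℂ) - 16 * (n : ℂ) - 16)
    / (2 * (k : ℂ) * ((n : ℂ) + 2) * (2 * (n : ℂ) + (k : ℂ) + 8))

/-- Recurrence coefficient `B_n(λ,k)`. -/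
noncomputable def Bcoef (k : ℕ) (lam : ℂ) (n : ℤ) : ℂ :=
  ((lam + 2 * (n : ℂ) + 3) * (lam + 2 * (n : ℂ) + 2))
    / (2 * (k : ℂ) * ((n : ℂ) + 2) * (2 * (n : ℂ) + (k : ℂ) + 8))

/-- Transport of a `HasSum` statement along pointwise equality. -/
theorem heun_aux_congr {f g : ℕ → ℂ} {s t : ℂ} (h : HasSum f s) (hf : ∀ n, g n = f n)
    (hs : t = s) : HasSum g t := by
  obtain rfl : g = f := funext hf
  rwa [hs]

/-- Termwise differentiation of a power series with complex coefficients, in a real variable. -/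
theorem heun_aux_deriv (a : ℕ → ℂ) (R : ℝ)
    (hsum : ∀ x : ℝ, |x| < R → Summable (fun n => a n * (x : ℂ) ^ n)) :
    (∀ x : ℝ, |x| < R → Summable (fun n : ℕ => (((n : ℂ) + 1) * a (n + 1)) * (x : ℂ) ^ n)) ∧
    (∀ x : ℝ, |x| < R → HasDerivAt (fun t : ℝ => ∑' n, a n * (t : ℂ) ^ n)
      (∑' n : ℕ, (((n : ℂ) + 1) * a (n + 1)) * (x : ℂ) ^ n) x) := by
  have key : ∀ s : ℝ, 0 < s → s < R →
      Summable (fun n : ℕ => ‖a n‖ * ((n : ℝ) * s ^ (n - 1))) := by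
    intro s hs hsR
    obtain ⟨r, hr1, hr2⟩ := exists_between hsR
    have hr0 : 0 < r := hs.trans hr1
    have hS := hsum r (by rwa [abs_of_pos hr0])
    obtain ⟨C, hC⟩ := hS.tendsto_atTop_zero.norm.bddAbove_range
    have hC' : ∀ n, ‖a n‖ * r ^ n ≤ C := by
      intro n
      have := hC ⟨n, rfl⟩
      simpa [abs_of_pos hr0] using this
    have hq : ‖s / r‖ < 1 := by
      rw [Real.norm_of_nonneg (by positivity), div_lt_one hr0]; exact hr1
    have h1 := (summable_pow_mul_geometric_of_norm_lt_one 1 hq).mul_left (C / s)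
    refine Summable.of_nonneg_of_le (fun n => by positivity) (fun n => ?_) h1
    rcases n with _ | n
    · simp
    · have e : ‖a (n + 1)‖ * (((n + 1 : ℕ) : ℝ) * s ^ (n + 1 - 1))
          = (‖a (n + 1)‖ * r ^ (n + 1)) * ((((n + 1 : ℕ) : ℝ) * (s / r) ^ (n + 1)) / s) := by
        rw [div_pow]; field_simp; simp [pow_succ]; ring
      have e2 : C / s * (((n + 1 : ℕ) : ℝ) ^ 1 * (s / r) ^ (n + 1))
          = C * ((((n + 1 : ℕ) : ℝ) * (s / r) ^ (n + 1)) / s) := by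
        ring
      rw [e, e2]
      exact mul_le_mul_of_nonneg_right (hC' _) (by positivity)
  have bd : ∀ (s x : ℝ), 0 < s → |x| ≤ s → ∀ n : ℕ,
      ‖a n * ((n : ℂ) * (x : ℂ) ^ (n - 1))‖ ≤ ‖a n‖ * ((n : ℝ) * s ^ (n - 1)) := by
    intro s x hs hx n
    simp only [norm_mul, norm_pow, Complex.norm_natCast, Complex.norm_real, Real.norm_eq_abs]
    gcongr
  have hsm : ∀ x : ℝ, |x| < R → Summable (fun n : ℕ => a n * ((n : ℂ) * (x : ℂ) ^ (n - 1))) := by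
    intro x hx
    obtain ⟨s, h1, h2⟩ := exists_between hx
    have hs : 0 < s := (abs_nonneg x).trans_lt h1
    exact Summable.of_norm_bounded (key s hs h2) (bd s x hs h1.le)
  have hshift : ∀ (x : ℝ), (fun n : ℕ => (((n : ℂ) + 1) * a (n + 1)) * (x : ℂ) ^ n)
      = fun n : ℕ => a (n + 1) * (((n + 1 : ℕ) : ℂ) * (x : ℂ) ^ (n + 1 - 1)) := by
    intro x; funext n; rw [Nat.add_sub_cancel]; push_cast; ring
  refine ⟨fun x hx => ?_, fun x hx => ?_⟩
  · rw [hshift]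
    exact (summable_nat_add_iff (f := fun n : ℕ => a n * ((n : ℂ) * (x : ℂ) ^ (n - 1))) 1).2
      (hsm x hx)
  · rw [hshift]
    have e : ∑' n : ℕ, a (n + 1) * (((n + 1 : ℕ) : ℂ) * (x : ℂ) ^ (n + 1 - 1))
        = ∑' n : ℕ, a n * ((n : ℂ) * (x : ℂ) ^ (n - 1)) := by
      rw [(hsm x hx).tsum_eq_zero_add]; simp
    rw [e]
    obtain ⟨s, h1, h2⟩ := exists_between hx
    have hs : 0 < s := (abs_nonneg x).trans_lt h1
    refine hasDerivAt_tsum_of_isPreconnected (u := fun n : ℕ => ‖a n‖ * ((n : ℝ) * s ^ (n - 1)))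
      (t := Set.Ioo (-s) s) (y₀ := x)
      (g := fun (n : ℕ) (t : ℝ) => a n * (t : ℂ) ^ n)
      (g' := fun (n : ℕ) (t : ℝ) => a n * ((n : ℂ) * (t : ℂ) ^ (n - 1)))
      (key s hs h2) isOpen_Ioo isPreconnected_Ioo ?_ ?_ (Set.mem_Ioo.2 (abs_lt.1 h1)) (hsum x hx)
      (Set.mem_Ioo.2 (abs_lt.1 h1))
    · intro n y _
      have := ((hasDerivAt_pow n (y : ℂ)).const_mul (a n)).comp_ofReal
      simpa using this
    · intro n y hy
      exact bd s y hs (abs_le.2 ⟨hy.1.le, hy.2.le⟩) n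

/-- If the power series `∑ aₙ xⁿ` built from the recurrence has radius of convergence
`R > 0`, then its sum satisfies the Heun equation on `(0, min R 1)`. -/
theorem heun_series_solution (k : ℕ) (hk : 2 ≤ k) (lam : ℂ) (a : ℕ → ℂ)
    (ha0 : a 0 = 1) (ha1 : a 1 = Acoef k lam (-1))
    (harec : ∀ n : ℕ, a (n + 2) = Acoef k lam n * a (n + 1) + Bcoef k lam n * a n)
    (R : ℝ) (hR : 0 < R)
    (hsum : ∀ x : ℝ, |x| < R → Summable (fun n => a n * (x : ℂ) ^ n)) :
    ∀ x : ℝ, 0 < x → x < min R 1 →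
      deriv (deriv (fun t : ℝ => ∑' n, a n * (t : ℂ) ^ n)) x
        + (1 / 2) * (((k : ℂ) + 6) / (x : ℂ) + (2 * lam - (k : ℂ) + 1) / ((x : ℂ) - 1))
            * deriv (fun t : ℝ => ∑' n, a n * (t : ℂ) ^ n) x
        + (1 / 4) * (((lam + 3) * (lam + 2) * (x : ℂ)
              + ((k : ℂ) * lam ^ 2 + 5 * (k : ℂ) * lam + 2 * (k : ℂ) - 4))
            / ((x : ℂ) * ((x : ℂ) - 1) * ((x : ℂ) + (k : ℂ))))
            * (∑' n, a n * (x : ℂ) ^ n) = 0 := by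
  intro x hx0 hxm
  obtain ⟨hxR, hx1⟩ := lt_min_iff.1 hxm
  have hxa : |x| < R := by rwa [abs_of_pos hx0]
  obtain ⟨hs1, hd1⟩ := heun_aux_deriv a R hsum
  obtain ⟨hs2, hd2⟩ := heun_aux_deriv (fun n : ℕ => ((n : ℂ) + 1) * a (n + 1)) R hs1
  have hev : deriv (fun t : ℝ => ∑' n, a n * (t : ℂ) ^ n) =ᶠ[nhds x]
      fun t : ℝ => ∑' n : ℕ, (((n : ℂ) + 1) * a (n + 1)) * (t : ℂ) ^ n := by
    have hopen : {t : ℝ | |t| < R} ∈ nhds x :=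
      (isOpen_lt continuous_abs continuous_const).mem_nhds hxa
    filter_upwards [hopen] with t ht
    exact (hd1 t ht).deriv
  rw [hev.deriv_eq, (hd2 x hxa).deriv, (hd1 x hxa).deriv]
  have H0 := (hsum x hxa).hasSum
  have H1 := (hs1 x hxa).hasSum
  have H2 := (hs2 x hxa).hasSum
  set S0 := ∑' n, a n * (x : ℂ) ^ n with hS0
  set S1 := ∑' n : ℕ, (((n : ℂ) + 1) * a (n + 1)) * (x : ℂ) ^ n with hS1
  set S2 := ∑' n : ℕ, (((n : ℂ) + 1) * ((((n + 1 : ℕ) : ℂ) + 1) * a (n + 1 + 1))) * (x : ℂ) ^ n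
    with hS2
  have T1 : HasSum (fun n : ℕ => (n : ℂ) * a n * (x : ℂ) ^ n) ((x : ℂ) * S1) := by
    rw [← hasSum_nat_add_iff' 1]
    refine heun_aux_congr (H1.mul_left (x : ℂ)) (fun n => ?_) ?_
    · push_cast; ring
    · simp
  have T2 : HasSum (fun n : ℕ => (n : ℂ) * ((n : ℂ) - 1) * a n * (x : ℂ) ^ n)
      ((x : ℂ) ^ 2 * S2) := by
    rw [← hasSum_nat_add_iff' 2]
    refine heun_aux_congr (H2.mul_left ((x : ℂ) ^ 2)) (fun n => ?_) ?_
    · push_cast; ring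
    · simp [Finset.sum_range_succ]
  have hk0 : (k : ℂ) ≠ 0 := by
    have : k ≠ 0 := by omega
    exact_mod_cast this
  have hxc : (x : ℂ) ≠ 0 := by exact_mod_cast hx0.ne'
  have hx1c : (x : ℂ) - 1 ≠ 0 := by
    have : x - 1 ≠ 0 := by linarith
    exact_mod_cast this
  have hxk : (x : ℂ) + k ≠ 0 := by
    have : x + k ≠ 0 := by positivity
    exact_mod_cast this
  -- the three parts of the operator, sorted by the shift of the index
  have P := (((T2.mul_left 4).add (T1.mul_left (14 + 4 * lam))).add
    (H0.mul_left ((lam + 3) * (lam + 2)))).mul_left ((x : ℂ) ^ 2)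
  have Q := (((T2.mul_left (4 * ((k : ℂ) - 1))).add
    (T1.mul_left (12 * (k : ℂ) - 12 + 4 * lam * k))).add
    (H0.mul_left ((k : ℂ) * lam ^ 2 + 5 * (k : ℂ) * lam + 2 * (k : ℂ) - 4))).mul_left (x : ℂ)
  have G := (T2.mul_left (-4 * (k : ℂ))).add (T1.mul_left (-2 * (k : ℂ) * (k + 6)))
  rw [← hasSum_nat_add_iff' 1] at Q
  rw [← hasSum_nat_add_iff' 2] at G
  have Z := (P.add Q).add G
  have h1' : 2 * (k : ℂ) * ((k : ℂ) + 6) * a 1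
      = (k : ℂ) * lam ^ 2 + 5 * (k : ℂ) * lam + 2 * (k : ℂ) - 4 := by
    have h6 : (k : ℂ) + 6 ≠ 0 := by exact_mod_cast (by omega : k + 6 ≠ 0)
    have h6' : (2 : ℂ) * (-1) + (k : ℂ) + 8 ≠ 0 := by
      intro h; apply h6; linear_combination h
    rw [ha1, Acoef]
    push_cast
    rw [mul_div_assoc', div_eq_iff (by
      refine mul_ne_zero (mul_ne_zero (mul_ne_zero two_ne_zero hk0) ?_) h6'
      norm_num)]
    ring
  have hrec' : ∀ n : ℕ, 2 * (k : ℂ) * ((n : ℂ) + 2) * (2 * (n : ℂ) + (k : ℂ) + 8) * a (n + 2)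
      = ((k : ℂ) * lam ^ 2 + (k : ℂ) * (4 * (n : ℂ) + 9) * lam + 4 * (k : ℂ) * (n : ℂ) ^ 2
      + 16 * (n : ℂ) * (k : ℂ) - 4 * (n : ℂ) ^ 2 + 14 * (k : ℂ) - 16 * (n : ℂ) - 16) * a (n + 1)
      + ((lam + 2 * (n : ℂ) + 3) * (lam + 2 * (n : ℂ) + 2)) * a n := by
    intro n
    have g1 : (n : ℂ) + 2 ≠ 0 := by exact_mod_cast (by omega : n + 2 ≠ 0)
    have g2 : 2 * (n : ℂ) + (k : ℂ) + 8 ≠ 0 := by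
      exact_mod_cast (by omega : 2 * n + k + 8 ≠ 0)
    rw [harec n, Acoef, Bcoef]
    push_cast
    field_simp
  have Z0 := Z.unique (by
    refine heun_aux_congr (hasSum_zero : HasSum (fun _ : ℕ => (0 : ℂ)) 0) (fun n => ?_) rfl
    have := hrec' n
    push_cast
    linear_combination (-(x : ℂ) ^ (n + 2)) * this)
  simp only [Finset.sum_range_succ, Finset.sum_range_zero, ha0] at Z0
  push_cast at Z0
  have fin : 4 * (x : ℂ) ^ 2 * ((x : ℂ) - 1) * ((x : ℂ) + k) * S2
      + 2 * (x : ℂ) * (((k : ℂ) + 6) * ((x : ℂ) - 1) * ((x : ℂ) + k)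
        + (2 * lam - k + 1) * (x : ℂ) * ((x : ℂ) + k)) * S1
      + (x : ℂ) * ((lam + 3) * (lam + 2) * (x : ℂ)
        + ((k : ℂ) * lam ^ 2 + 5 * (k : ℂ) * lam + 2 * (k : ℂ) - 4)) * S0 = 0 := by
    linear_combination Z0 - (x : ℂ) * h1'
  have hD : 4 * (x : ℂ) ^ 2 * ((x : ℂ) - 1) * ((x : ℂ) + k) ≠ 0 := by
    refine mul_ne_zero (mul_ne_zero (mul_ne_zero (by norm_num) ?_) hx1c) hxk
    exact pow_ne_zero _ hxc
  refine (mul_eq_zero.1 (?_ : 4 * (x : ℂ) ^ 2 * ((x : ℂ) - 1) * ((x : ℂ) + k) * _ = 0)).resolve_left hD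
  rw [← fin]
  field_simp
  ring
end

section
/- Let λ ∈ ℂ with Re λ ≥ 0 and let a_n(λ) be the d = 3 sequence defined by a_{−1} = 0, a_0 = 1, a_{n+2} = A_n(λ)·a_{n+1} + B_n(λ)·a_n with A_n(λ) = (12n² + (8λ+56)n + λ² + 20λ + 56)/(8n² + 52n + 72) and B_n(λ) = −(4n² + (4λ+12)n + λ² + 6λ + 8)/(8n² + 52n + 72). Then a_n(λ) ≠ 0 for all n ≥ 1 and r_n(λ) = a_{n+1}(λ)/a_n(λ) → 1 as n → ∞. -/
/-- The `d = 3` recurrence coefficient `A_n(λ)`. -/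
noncomputable def A3 (lam : ℂ) (n : ℤ) : ℂ :=
  (12 * (n : ℂ) ^ 2 + (8 * lam + 56) * (n : ℂ) + lam ^ 2 + 20 * lam + 56)
    / (8 * (n : ℂ) ^ 2 + 52 * (n : ℂ) + 72)

/-- The `d = 3` recurrence coefficient `B_n(λ)`. -/
noncomputable def B3 (lam : ℂ) (n : ℤ) : ℂ :=
  -(4 * (n : ℂ) ^ 2 + (4 * lam + 12) * (n : ℂ) + lam ^ 2 + 6 * lam + 8)
    / (8 * (n : ℂ) ^ 2 + 52 * (n : ℂ) + 72)

/-- Numerator of the quasi-solution. -/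
noncomputable def Rq (lam : ℂ) (n : ℕ) : ℂ :=
  lam ^ 2 + (8 * (n : ℂ) + 12) * lam + (8 * (n : ℂ) ^ 2 + 20 * (n : ℂ) + 12)

/-- Denominator of the quasi-solution. -/
noncomputable def dq (n : ℕ) : ℂ := 4 * (2 * (n : ℂ) + 7) * ((n : ℂ) + 1)

/-- Numerator of `A3`. -/
noncomputable def alq (lam : ℂ) (n : ℕ) : ℂ :=
  12 * (n : ℂ) ^ 2 + (8 * lam + 56) * (n : ℂ) + lam ^ 2 + 20 * lam + 56

/-- Minus the numerator of `B3`. -/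
noncomputable def beq (lam : ℂ) (n : ℕ) : ℂ :=
  4 * (n : ℂ) ^ 2 + (4 * lam + 12) * (n : ℂ) + lam ^ 2 + 6 * lam + 8

lemma dq_ne (n : ℕ) : dq n ≠ 0 := by
  have h : dq n = ((4 * (2 * n + 7) * (n + 1) : ℕ) : ℂ) := by unfold dq; push_cast; ring
  rw [h, Nat.cast_ne_zero]
  positivity

lemma Rq_normSq (x y : ℝ) (n : ℕ) : Complex.normSq (Rq ⟨x, y⟩ n) =
    (x ^ 2 - y ^ 2 + (8 * n + 12) * x + (8 * (n : ℝ) ^ 2 + 20 * n + 12)) ^ 2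
      + (2 * x * y + (8 * n + 12) * y) ^ 2 := by
  have h : Rq ⟨x, y⟩ n =
    ⟨x ^ 2 - y ^ 2 + (8 * n + 12) * x + (8 * (n : ℝ) ^ 2 + 20 * n + 12),
      2 * x * y + (8 * n + 12) * y⟩ := by
    unfold Rq
    apply Complex.ext <;> simp [pow_two] <;> ring
  rw [h, Complex.normSq_mk]; ring

lemma Rq_ne (lam : ℂ) (hre : 0 ≤ lam.re) (n : ℕ) : Rq lam n ≠ 0 := by
  obtain ⟨x, y⟩ := lam
  change 0 ≤ x at hre
  rw [← Complex.normSq_pos, Rq_normSq]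
  ring_nf
  positivity

set_option maxHeartbeats 4000000 in
lemma key_sq (lam : ℂ) (hre : 0 ≤ lam.re) (n : ℕ) :
    36 * Complex.normSq ((alq lam n - Rq lam (n + 1)) * Rq lam n - beq lam n * dq n)
      + 3 * Complex.normSq (beq lam n * dq n)
      ≤ Complex.normSq (Rq lam n * Rq lam (n + 1)) := by
  obtain ⟨x, y⟩ := lam
  change 0 ≤ x at hre
  have hB : beq ⟨x, y⟩ n * dq n =
      ⟨(x ^ 2 - y ^ 2 + (4 * n + 6) * x + (4 * (n : ℝ) ^ 2 + 12 * n + 8)) *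
          (4 * (2 * n + 7) * (n + 1)),
        (2 * x * y + (4 * n + 6) * y) * (4 * (2 * n + 7) * (n + 1))⟩ := by
    unfold beq dq
    apply Complex.ext <;> simp [pow_two, -mul_eq_mul_right_iff, -mul_eq_mul_left_iff] <;> ring
  have hX : (alq ⟨x, y⟩ n - Rq ⟨x, y⟩ (n + 1)) * Rq ⟨x, y⟩ n - beq ⟨x, y⟩ n * dq n =
      ⟨(4 * (n : ℝ) ^ 2 + 20 * n + 16) *
          (x ^ 2 - y ^ 2 + (8 * n + 12) * x + (8 * (n : ℝ) ^ 2 + 20 * n + 12)) -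
          (x ^ 2 - y ^ 2 + (4 * n + 6) * x + (4 * (n : ℝ) ^ 2 + 12 * n + 8)) *
          (4 * (2 * n + 7) * (n + 1)),
        (4 * (n : ℝ) ^ 2 + 20 * n + 16) * (2 * x * y + (8 * n + 12) * y) -
        (2 * x * y + (4 * n + 6) * y) * (4 * (2 * n + 7) * (n + 1))⟩ := by
    rw [hB]
    unfold alq Rq
    apply Complex.ext <;> simp [pow_two] <;> ring
  rw [hX, hB, Complex.normSq_mul, Rq_normSq, Rq_normSq, Complex.normSq_mk, Complex.normSq_mk,
    ← sub_nonneg]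
  push_cast
  ring_nf
  positivity

lemma key (lam : ℂ) (hre : 0 ≤ lam.re) (n : ℕ) :
    ‖(alq lam n - Rq lam (n + 1)) * Rq lam n - beq lam n * dq n‖
      + 1 / 2 * ‖beq lam n * dq n‖ ≤ 1 / 3 * (‖Rq lam n‖ * ‖Rq lam (n + 1)‖) := by
  have h := key_sq lam hre n
  rw [Complex.normSq_eq_norm_sq, Complex.normSq_eq_norm_sq, Complex.normSq_eq_norm_sq] at h
  rw [← norm_mul]
  set X := ‖(alq lam n - Rq lam (n + 1)) * Rq lam n - beq lam n * dq n‖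
  set B := ‖beq lam n * dq n‖
  refine abs_le_of_sq_le_sq' ?_ (by positivity) |>.2
  nlinarith [sq_nonneg (6 * X - B)]

lemma A3_eq (lam : ℂ) (n : ℕ) : A3 lam n = alq lam n / dq (n + 1) := by
  unfold A3 alq dq
  push_cast
  congr 1
  ring

lemma B3_eq (lam : ℂ) (n : ℕ) : B3 lam n = -beq lam n / dq (n + 1) := by
  unfold B3 beq dq
  push_cast
  congr 1
  ring

lemma main_ind (lam : ℂ) (hre : 0 ≤ lam.re) (a : ℕ → ℂ)
    (ha0 : a 0 = 1) (ha1 : a 1 = A3 lam (-1))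
    (harec : ∀ n : ℕ, a (n + 2) = A3 lam n * a (n + 1) + B3 lam n * a n) (n : ℕ) :
    a n ≠ 0 ∧ ‖dq n * a (n + 1) - Rq lam n * a n‖ ≤ 1 / 3 * ‖Rq lam n * a n‖ := by
  induction n with
  | zero =>
    refine ⟨by simp [ha0], ?_⟩
    have : dq 0 * a (0 + 1) - Rq lam 0 * a 0 = 0 := by
      rw [zero_add, ha0, ha1]
      unfold dq Rq A3
      push_cast
      ring
    rw [this, norm_zero]
    positivity
  | succ n ih =>
    obtain ⟨hv, hd⟩ := ih
    have hR := Rq_ne lam hre n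
    have hRv : 0 < ‖Rq lam n * a n‖ := norm_pos_iff.mpr (mul_ne_zero hR hv)
    have h1 : ‖Rq lam n * a n‖ ≤ ‖dq n * a (n + 1)‖ + ‖dq n * a (n + 1) - Rq lam n * a n‖ := by
      have := norm_sub_norm_le (Rq lam n * a n) (dq n * a (n + 1))
      rw [norm_sub_rev] at this
      linarith
    have hu : a (n + 1) ≠ 0 := by
      intro h0
      rw [h0] at h1 hd
      simp only [mul_zero, norm_zero, zero_sub, norm_neg] at h1 hd
      linarith
    refine ⟨hu, ?_⟩
    have h2 : ‖dq n * a (n + 1) - Rq lam n * a n‖ ≤ 1 / 2 * ‖dq n * a (n + 1)‖ := by linarith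
    have hD := dq_ne (n + 1)
    have e1 : dq (n + 1) * a (n + 2) = alq lam n * a (n + 1) - beq lam n * a n := by
      rw [harec, A3_eq, B3_eq]
      field_simp
      ring
    have e2 : Rq lam n * (dq (n + 1) * a (n + 2) - Rq lam (n + 1) * a (n + 1)) =
        ((alq lam n - Rq lam (n + 1)) * Rq lam n - beq lam n * dq n) * a (n + 1)
          + beq lam n * (dq n * a (n + 1) - Rq lam n * a n) := by
      rw [e1]; ring
    have hk := mul_le_mul_of_nonneg_right (key lam hre n) (norm_nonneg (a (n + 1)))
    have h3 : ‖Rq lam n‖ * ‖dq (n + 1) * a (n + 2) - Rq lam (n + 1) * a (n + 1)‖ ≤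
        ‖Rq lam n‖ * (1 / 3 * ‖Rq lam (n + 1) * a (n + 1)‖) := by
      rw [← norm_mul, e2]
      refine (norm_add_le _ _).trans ?_
      rw [norm_mul _ (a (n + 1)), norm_mul (beq lam n), norm_mul (Rq lam (n + 1))]
      have h4 := mul_le_mul_of_nonneg_left h2 (norm_nonneg (beq lam n))
      rw [norm_mul (dq n)] at h4
      rw [norm_mul (beq lam n)] at hk
      linarith
    exact le_of_mul_le_mul_left h3 (norm_pos_iff.mpr hR)

lemma tendsto_zero_of_contract (u e : ℕ → ℝ) (hu : ∀ n, 0 ≤ u n)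
    (he : Filter.Tendsto e Filter.atTop (nhds 0))
    (h : ∀ᶠ n in Filter.atTop, u (n + 1) ≤ e n + 4 / 5 * u n) :
    Filter.Tendsto u Filter.atTop (nhds 0) := by
  rw [Metric.tendsto_atTop]
  intro ε hε
  have h2 : ∀ᶠ n in Filter.atTop, e n < ε / 10 := he.eventually_lt_const (by positivity)
  obtain ⟨N, hN⟩ := Filter.eventually_atTop.mp (h.and h2)
  have hind : ∀ k, u (N + k) ≤ ε / 2 + (4 / 5) ^ k * u N := by
    intro k
    induction k with
    | zero => simp; positivity
    | succ k ih =>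
      have := hN (N + k) (by omega)
      rw [← add_assoc, pow_succ]
      nlinarith [this.1, this.2]
  have h3 : Filter.Tendsto (fun k : ℕ => ((4 / 5 : ℝ)) ^ k * u N) Filter.atTop (nhds 0) := by
    have := (tendsto_pow_atTop_nhds_zero_of_lt_one (r := (4 / 5 : ℝ)) (by norm_num)
      (by norm_num)).mul_const (u N)
    simpa using this
  obtain ⟨K, hK⟩ := Filter.eventually_atTop.mp
    (h3.eventually_lt_const (show (0 : ℝ) < ε / 2 by positivity))
  refine ⟨N + K, fun n hn => ?_⟩
  obtain ⟨k, rfl⟩ := Nat.exists_eq_add_of_le (show N ≤ n by omega)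
  rw [Real.dist_eq, sub_zero, abs_of_nonneg (hu _)]
  linarith [hind k, hK k (by omega)]

lemma tendsto_quad (p q r p' q' r' : ℂ) (hp : p' ≠ 0) :
    Filter.Tendsto (fun n : ℕ => (p * (n : ℂ) ^ 2 + q * n + r) / (p' * (n : ℂ) ^ 2 + q' * n + r'))
      Filter.atTop (nhds (p / p')) := by
  have hi : Filter.Tendsto (fun n : ℕ => ((n : ℂ))⁻¹) Filter.atTop (nhds 0) :=
    tendsto_inv_atTop_nhds_zero_nat
  have hq : ∀ p q r : ℂ, Filter.Tendsto
      (fun n : ℕ => p + q * ((n : ℂ))⁻¹ + r * (((n : ℂ))⁻¹ * ((n : ℂ))⁻¹)) Filter.atTop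
      (nhds p) := by
    intro p q r
    have := ((hi.const_mul q).const_add p).add ((hi.mul hi).const_mul r)
    simpa using this
  refine ((hq p q r).div (hq p' q' r') hp).congr' ?_
  filter_upwards [Filter.eventually_ge_atTop 1] with n hn
  have hn0 : (n : ℂ) ≠ 0 := by exact_mod_cast (by omega : n ≠ 0)
  have e : ∀ p q r : ℂ, p + q * ((n : ℂ))⁻¹ + r * (((n : ℂ))⁻¹ * ((n : ℂ))⁻¹) =
      (p * (n : ℂ) ^ 2 + q * n + r) / (n : ℂ) ^ 2 := by
    intro p q r; field_simp
  simp only [Pi.div_apply]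
  rw [e, e, div_div_div_cancel_right₀ (pow_ne_zero 2 hn0)]

/-- In the `d = 3` case, for `Re λ ≥ 0` the terms `aₙ(λ)` are nonzero for `n ≥ 1` and the
ratios `rₙ(λ) = aₙ₊₁/aₙ` converge to `1`. -/
theorem d3_ratios_tendsto_one (lam : ℂ) (hre : 0 ≤ lam.re) (a : ℕ → ℂ)
    (ha0 : a 0 = 1) (ha1 : a 1 = A3 lam (-1))
    (harec : ∀ n : ℕ, a (n + 2) = A3 lam n * a (n + 1) + B3 lam n * a n) :
    (∀ n : ℕ, 1 ≤ n → a n ≠ 0) ∧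
    Filter.Tendsto (fun n => a (n + 1) / a n) Filter.atTop (nhds 1) := by
  have hm := main_ind lam hre a ha0 ha1 harec
  refine ⟨fun n _ => (hm n).1, ?_⟩
  have hA : Filter.Tendsto (fun n : ℕ => A3 lam n) Filter.atTop (nhds (12 / 8)) := by
    refine (tendsto_quad 12 (8 * lam + 56) (lam ^ 2 + 20 * lam + 56) 8 52 72
      (by norm_num)).congr fun n => ?_
    unfold A3
    push_cast
    congr 1
    ring
  have hB : Filter.Tendsto (fun n : ℕ => B3 lam n) Filter.atTop (nhds (-4 / 8)) := by
    refine (tendsto_quad (-4) (-(4 * lam + 12)) (-(lam ^ 2 + 6 * lam + 8)) 8 52 72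
      (by norm_num)).congr fun n => ?_
    unfold B3
    push_cast
    congr 1
    ring
  have hRd : Filter.Tendsto (fun n : ℕ => dq n / Rq lam n) Filter.atTop (nhds (8 / 8)) := by
    refine (tendsto_quad 8 36 28 8 (8 * lam + 20) (lam ^ 2 + 12 * lam + 12)
      (by norm_num)).congr fun n => ?_
    unfold dq Rq
    congr 1 <;> ring
  have hE : Filter.Tendsto (fun n : ℕ => ‖A3 lam n + B3 lam n - 1‖) Filter.atTop (nhds 0) := by
    have := ((hA.add hB).sub_const 1).norm
    convert this using 2
    norm_num
  have hC : Filter.Tendsto (fun n : ℕ => ‖B3 lam n‖ * ‖dq n / Rq lam n‖) Filter.atTop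
      (nhds (1 / 2)) := by
    have := hB.norm.mul hRd.norm
    convert this using 2
    norm_num
  have hCe : ∀ᶠ n : ℕ in Filter.atTop, ‖B3 lam n‖ * ‖dq n / Rq lam n‖ < 8 / 15 :=
    hC.eventually_lt_const (by norm_num)
  rw [tendsto_iff_norm_sub_tendsto_zero]
  refine tendsto_zero_of_contract _ _ (fun n => norm_nonneg _) hE ?_
  filter_upwards [hCe] with n hn
  have hv := (hm n).1
  have hu := (hm (n + 1)).1
  have hR := Rq_ne lam hre n
  have e1 : a (n + 1 + 1) / a (n + 1) - 1 = (A3 lam n + B3 lam n - 1)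
      - (B3 lam n * (a n / a (n + 1))) * (a (n + 1) / a n - 1) := by
    rw [show n + 1 + 1 = n + 2 from rfl, harec]
    field_simp
    ring
  have h1 : 2 / 3 * ‖Rq lam n * a n‖ ≤ ‖dq n * a (n + 1)‖ := by
    have := norm_sub_norm_le (Rq lam n * a n) (dq n * a (n + 1))
    rw [norm_sub_rev] at this
    linarith [(hm n).2]
  have h2 : ‖a n / a (n + 1)‖ ≤ 3 / 2 * ‖dq n / Rq lam n‖ := by
    rw [norm_div, norm_div, ← mul_div_assoc, div_le_div_iff₀ (norm_pos_iff.mpr hu)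
      (norm_pos_iff.mpr hR)]
    rw [norm_mul, norm_mul] at h1
    linarith
  have h3 : ‖B3 lam n * (a n / a (n + 1))‖ ≤ 4 / 5 := by
    rw [norm_mul]
    have := mul_le_mul_of_nonneg_left h2 (norm_nonneg (B3 lam n))
    linarith
  rw [e1]
  refine (norm_sub_le _ _).trans ?_
  rw [norm_mul (B3 lam n * (a n / a (n + 1)))]
  have := mul_le_mul_of_nonneg_right h3 (norm_nonneg (a (n + 1) / a n - 1))
  linarith
end
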